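/- Fix a nonzero vector v ∈ F_q^n, a nonzero linear functional λ on F_q^m, and 0 ≤ k ≤ m ≤ n. Then the number of rank-k matrices A ∈ M_{m,n}(F_q) (viewed as linear maps F_q^n → F_q^m) satisfying λ(A v) = 0 but with A v ≠ 0 and with image of A not contained in the kernel of λ, equals (#Γ_{n,k} − #Γ_{n−1,k}) · (((q^{m−1} − 1)/(q^m − 1)) · #Γ_{m,k} − #Γ_{m−1,k}) · #GL_k. -/

import Mathlib

open Matrix
open scoped BigOperators

/-- The number of `k`-dimensional `F`-subspaces of `F^j` (the Grassmannian cardinality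
`#Γ_{j,k}`; it is `0` when `k > j`). -/
noncomputable def grassCard (F : Type) [Field F] [Fintype F] (j k : ℕ) : ℕ :=
  Nat.card {W : Submodule F (Fin j → F) // Module.finrank F W = k}

/-- The order of `GL_k(F_q)`, namely `∏_{a=0}^{k-1} (q^k − q^a)`. -/
def cardGL (q k : ℕ) : ℕ := ∏ a ∈ Finset.range k, (q ^ k - q ^ a)

open Module

section RankCount

variable {F V W V' W' : Type*} [Field F]
  [AddCommGroup V] [Module F V] [AddCommGroup W] [Module F W]
  [AddCommGroup V'] [Module F V'] [AddCommGroup W'] [Module F W']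

variable (F V W) in
/-- The number of linear maps `V → W` of rank `k`. -/
noncomputable def rankCard (k : ℕ) : ℕ :=
  Nat.card {f : V →ₗ[F] W // finrank F (LinearMap.range f) = k}

theorem finite_linearMap [Finite V] [Finite W] : Finite (V →ₗ[F] W) :=
  Finite.of_injective _ DFunLike.coe_injective

theorem natCard_and_add_natCard_and_not {α : Type*} [Finite α] (p r : α → Prop) :
    Nat.card {x // p x ∧ r x} + Nat.card {x // p x ∧ ¬ r x} = Nat.card {x // p x} := by
  classical
  have := Fintype.ofFinite α
  simp only [Nat.card_eq_fintype_card, Fintype.card_subtype, ← Finset.filter_filter]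
  exact Finset.card_filter_add_card_filter_not _

theorem finrank_range_equiv_comp (e : W ≃ₗ[F] W') (f : V →ₗ[F] W) :
    finrank F (LinearMap.range (e.toLinearMap ∘ₗ f)) = finrank F (LinearMap.range f) := by
  rw [LinearMap.range_comp]
  exact e.finrank_map_eq _

theorem range_comp_equiv (e : V' ≃ₗ[F] V) (f : V →ₗ[F] W) :
    LinearMap.range (f ∘ₗ e.toLinearMap) = LinearMap.range f :=
  LinearMap.range_comp_of_range_eq_top _ e.range

theorem rankCard_congr (e : V ≃ₗ[F] V') (e' : W ≃ₗ[F] W') (k : ℕ) :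
    rankCard F V W k = rankCard F V' W' k := by
  refine Nat.card_congr ((e.arrowCongr e').toEquiv.subtypeEquiv fun f => ?_)
  change _ ↔ finrank F (LinearMap.range (e'.toLinearMap ∘ₗ f ∘ₗ e.symm.toLinearMap)) = k
  rw [finrank_range_equiv_comp, range_comp_equiv]

theorem rankCard_eq_natCard_matrix (m n k : ℕ) :
    rankCard F (Fin n → F) (Fin m → F) k =
      Nat.card {A : Matrix (Fin m) (Fin n) F // A.rank = k} := by
  refine (Nat.card_congr ((Matrix.toLin' (R := F)).toEquiv.subtypeEquiv fun A => ?_)).symm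
  rfl

theorem rankCard_swap (m n k : ℕ) :
    rankCard F (Fin n → F) (Fin m → F) k = rankCard F (Fin m → F) (Fin n → F) k := by
  rw [rankCard_eq_natCard_matrix, rankCard_eq_natCard_matrix]
  refine Nat.card_congr
    ((Matrix.transposeAddEquiv (Fin m) (Fin n) F).toEquiv.subtypeEquiv fun A => ?_)
  simp [Matrix.rank_transpose]

theorem rankCard_square [Fintype F] (k : ℕ) :
    rankCard F (Fin k → F) (Fin k → F) k = cardGL (Fintype.card F) k := by
  have h := card_linearIndependent (K := F) (V := Fin k → F) (k := k) (by simp)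
  rw [finrank_fin_fun, Fin.prod_univ_eq_prod_range
    (fun i => Fintype.card F ^ k - Fintype.card F ^ i)] at h
  rw [rankCard_eq_natCard_matrix, cardGL, ← h]
  refine Nat.card_congr ((Equiv.refl _).subtypeEquiv fun A => ?_)
  change A.rank = k ↔ LinearIndependent F A.row
  rw [Matrix.rank_eq_finrank_span_row, linearIndependent_iff_card_eq_finrank_span,
    Fintype.card_fin, Set.finrank, eq_comm]

/-- A rank-`k` map is its range together with a surjection onto that range. -/
theorem rankCard_eq_natCard_mul [FiniteDimensional F W] (k : ℕ) :
    rankCard F V W k =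
      Nat.card {U : Submodule F W // finrank F U = k} * rankCard F V (Fin k → F) k := by
  rw [rankCard, rankCard, ← Nat.card_prod]
  let e (U : {U : Submodule F W // finrank F U = k}) : U.1 ≃ₗ[F] (Fin k → F) :=
    LinearEquiv.ofFinrankEq _ _ (by rw [U.2, finrank_fin_fun])
  have hr (U : {U : Submodule F W // finrank F U = k}) (g : V →ₗ[F] (Fin k → F))
      (hg : finrank F (LinearMap.range g) = k) :
      LinearMap.range (U.1.subtype ∘ₗ (e U).symm.toLinearMap ∘ₗ g) = U.1 := by
    have : LinearMap.range g = ⊤ := Submodule.eq_top_of_finrank_eq (by rw [hg, finrank_fin_fun])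
    rw [LinearMap.range_comp, LinearMap.range_comp, this, Submodule.map_top, LinearEquiv.range,
      Submodule.map_top, Submodule.range_subtype]
  refine (Nat.card_congr (Equiv.ofBijective
    (fun x => ⟨x.1.1.subtype ∘ₗ (e x.1).symm.toLinearMap ∘ₗ x.2.1,
      by rw [hr _ _ x.2.2, x.1.2]⟩) ⟨?_, ?_⟩)).symm
  · rintro ⟨U, g, hg⟩ ⟨U', g', hg'⟩ h
    have h := congrArg Subtype.val h
    obtain rfl : U = U' := by
      apply Subtype.ext
      rw [← hr U g hg, ← hr U' g' hg']
      exact congrArg LinearMap.range h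
    obtain rfl : g = g' := by
      ext1 x
      simpa using LinearMap.congr_fun h x
    rfl
  · rintro ⟨f, hf⟩
    refine ⟨⟨⟨LinearMap.range f, hf⟩, (e ⟨_, hf⟩).toLinearMap ∘ₗ f.rangeRestrict, ?_⟩, ?_⟩
    · rw [finrank_range_equiv_comp, LinearMap.range_rangeRestrict, finrank_top, hf]
    · ext x
      simp

theorem rankCard_restrict (U : Submodule F W) (p : (V →ₗ[F] W) → Prop) (k : ℕ) :
    Nat.card {f : V →ₗ[F] W //
        (finrank F (LinearMap.range f) = k ∧ p f) ∧ LinearMap.range f ≤ U} =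
      Nat.card {g : V →ₗ[F] U // finrank F (LinearMap.range g) = k ∧ p (U.subtype ∘ₗ g)} := by
  have hr (g : V →ₗ[F] U) :
      finrank F (LinearMap.range (U.subtype ∘ₗ g)) = finrank F (LinearMap.range g) := by
    rw [LinearMap.range_comp, Submodule.finrank_map_subtype_eq]
  refine (Nat.card_congr (Equiv.ofBijective
    (fun g => ⟨U.subtype ∘ₗ g.1, ⟨by rw [hr, g.2.1], g.2.2⟩,
      by rintro _ ⟨x, rfl⟩; exact (g.1 x).2⟩) ⟨?_, ?_⟩)).symm
  · rintro ⟨g, hg⟩ ⟨g', hg'⟩ h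
    ext x
    exact LinearMap.congr_fun (congrArg Subtype.val h) x
  · rintro ⟨f, ⟨hf, hp⟩, hU⟩
    have hc : U.subtype ∘ₗ f.codRestrict U (fun x => hU ⟨x, rfl⟩) = f := by ext x; rfl
    exact ⟨⟨f.codRestrict U (fun x => hU ⟨x, rfl⟩), by rw [← hr, hc, hf], by rwa [hc]⟩,
      Subtype.ext hc⟩

theorem natCard_rank_and_apply_eq_zero (v : V) (k : ℕ) :
    Nat.card {f : V →ₗ[F] W // finrank F (LinearMap.range f) = k ∧ f v = 0} =
      rankCard F (V ⧸ Submodule.span F {v}) W k := by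
  have hr (g : (V ⧸ Submodule.span F {v}) →ₗ[F] W) :
      LinearMap.range (g ∘ₗ (Submodule.span F {v}).mkQ) = LinearMap.range g :=
    LinearMap.range_comp_of_range_eq_top _ (Submodule.range_mkQ _)
  have hv0 : (Submodule.span F {v}).mkQ v = 0 := by simp
  refine (Nat.card_congr (Equiv.ofBijective
    (fun g => ⟨g.1 ∘ₗ (Submodule.span F {v}).mkQ, by rw [hr, g.2],
      by rw [LinearMap.comp_apply, hv0, map_zero]⟩) ⟨?_, ?_⟩)).symm
  · rintro ⟨g, hg⟩ ⟨g', hg'⟩ h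
    exact Subtype.ext (Submodule.linearMap_qext _ (congrArg Subtype.val h))
  · rintro ⟨f, hf, hv⟩
    have hc : Submodule.liftQSpanSingleton v f hv ∘ₗ (Submodule.span F {v}).mkQ = f := by
      ext x; rfl
    exact ⟨⟨Submodule.liftQSpanSingleton v f hv, by rw [← hr, hc, hf]⟩, Subtype.ext hc⟩

theorem natCard_rank_and_apply_ne_zero [Finite V] [Finite W] (v : V) (k : ℕ) :
    rankCard F (V ⧸ Submodule.span F {v}) W k +
      Nat.card {f : V →ₗ[F] W // finrank F (LinearMap.range f) = k ∧ f v ≠ 0} =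
    rankCard F V W k := by
  have := finite_linearMap (F := F) (V := V) (W := W)
  rw [← natCard_rank_and_apply_eq_zero]
  exact natCard_and_add_natCard_and_not _ _

theorem exists_linearEquiv_apply_eq [FiniteDimensional F W] {u w : W} (hu : u ≠ 0) (hw : w ≠ 0) :
    ∃ e : W ≃ₗ[F] W, e u = w := by
  obtain ⟨e, he⟩ := Submodule.exists_linearEquiv_restrict_eq
    ((LinearEquiv.toSpanNonzeroSingleton F W u hu).symm ≪≫ₗ
      LinearEquiv.toSpanNonzeroSingleton F W w hw)
  refine ⟨e, ?_⟩
  have := he (LinearEquiv.toSpanNonzeroSingleton F W u hu 1)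
  rw [LinearEquiv.trans_apply, LinearEquiv.symm_apply_apply] at this
  simpa only [LinearEquiv.toSpanNonzeroSingleton_apply, one_smul] using this.symm

/-- The value at `v` of a rank-`k` map is equidistributed over the nonzero vectors. -/
theorem natCard_rank_and_apply_mem [FiniteDimensional F W] (v : V) {u : W} (hu : u ≠ 0)
    (T : Set W) (hT : ∀ w ∈ T, w ≠ 0) (k : ℕ) :
    Nat.card {f : V →ₗ[F] W // finrank F (LinearMap.range f) = k ∧ f v ∈ T} =
      Nat.card T *
        Nat.card {f : V →ₗ[F] W // finrank F (LinearMap.range f) = k ∧ f v = u} := by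
  choose e he using fun w : T => exists_linearEquiv_apply_eq (F := F) hu (hT w w.2)
  rw [← Nat.card_prod]
  refine (Nat.card_congr (Equiv.ofBijective
    (fun x => ⟨(e x.1).toLinearMap ∘ₗ x.2.1, by rw [finrank_range_equiv_comp, x.2.2.1],
      by simp [x.2.2.2, he]⟩) ⟨?_, ?_⟩)).symm
  · rintro ⟨w, f, hf, hfv⟩ ⟨w', f', hf', hfv'⟩ h
    have h := congrArg Subtype.val h
    obtain rfl : w = w' := by
      have := LinearMap.congr_fun h v
      simp only [LinearMap.comp_apply, hfv, hfv', LinearEquiv.coe_coe, he] at this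
      exact Subtype.ext this
    obtain rfl : f = f' := by
      ext1 x
      simpa using LinearMap.congr_fun h x
    rfl
  · rintro ⟨f, hf, hfv⟩
    refine ⟨⟨⟨f v, hfv⟩, (e ⟨f v, hfv⟩).symm.toLinearMap ∘ₗ f, ?_, ?_⟩, ?_⟩
    · rw [finrank_range_equiv_comp, hf]
    · simp [LinearEquiv.symm_apply_eq, he]
    · ext x
      simp

end RankCount

theorem natCard_submodule_ne_zero {F W : Type*} [Field F] [Fintype F] [AddCommGroup W]
    [Module F W] [Finite W] (U : Submodule F W) :
    (Nat.card {w : W | w ∈ U ∧ w ≠ 0} : ℚ) = (Fintype.card F : ℚ) ^ finrank F U - 1 := by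
  have h := natCard_and_add_natCard_and_not (fun w : W => w ∈ U) (· = 0)
  have h0 : Nat.card {w : W // w ∈ U ∧ w = 0} = 1 := by
    rw [Nat.card_eq_one_iff_unique]
    exact ⟨⟨fun a b => Subtype.ext (a.2.2.trans b.2.2.symm)⟩, ⟨0, U.zero_mem, rfl⟩⟩
  have hU : Nat.card {w : W // w ∈ U} = Fintype.card F ^ finrank F U := by
    rw [← Nat.card_eq_fintype_card]
    exact natCard_eq_pow_finrank (K := F) (V := U)
  rw [h0, hU] at h
  rw [eq_sub_iff_add_eq']
  exact_mod_cast h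

theorem rankCard_eq_grassCard {F : Type} {V W : Type*} [Field F] [Fintype F]
    [AddCommGroup V] [Module F V] [FiniteDimensional F V]
    [AddCommGroup W] [Module F W] [FiniteDimensional F W] {m n : ℕ}
    (hV : finrank F V = n) (hW : finrank F W = m) (k : ℕ) :
    rankCard F V W k = grassCard F m k * (grassCard F n k * cardGL (Fintype.card F) k) := by
  rw [rankCard_congr (LinearEquiv.ofFinrankEq V (Fin n → F) (by simp [hV]))
      (LinearEquiv.ofFinrankEq W (Fin m → F) (by simp [hW])),
    rankCard_eq_natCard_mul, rankCard_swap, rankCard_eq_natCard_mul, rankCard_square]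
  rfl

/-- for a nonzero vector `v ∈ F_q^n`, a nonzero linear functional `λ` on
`F_q^m`, and `0 ≤ k ≤ m ≤ n`, the number of rank-`k` matrices `A ∈ M_{m,n}(F_q)` with
`λ(A v) = 0`, `A v ≠ 0`, and image of `A` not contained in `ker λ`, equals
`(#Γ_{n,k} − #Γ_{n−1,k}) · (((q^{m−1} − 1)/(q^m − 1))·#Γ_{m,k} − #Γ_{m−1,k}) · #GL_k`. -/
theorem card_rank_generic_pairing (F : Type) [Field F] [Fintype F]
    (m n k : ℕ) (hkm : k ≤ m) (hmn : m ≤ n)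
    (v : Fin n → F) (hv : v ≠ 0)
    (lam : (Fin m → F) →ₗ[F] F) (hlam : lam ≠ 0) :
    (Nat.card {A : Matrix (Fin m) (Fin n) F //
        A.rank = k ∧ lam (A.mulVec v) = 0 ∧ A.mulVec v ≠ 0 ∧
          ¬ LinearMap.range A.mulVecLin ≤ LinearMap.ker lam} : ℚ) =
      ((grassCard F n k : ℚ) - grassCard F (n - 1) k) *
        ((((Fintype.card F : ℚ) ^ (m - 1) - 1) / ((Fintype.card F : ℚ) ^ m - 1))
            * (grassCard F m k : ℚ) - grassCard F (m - 1) k) *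
        (cardGL (Fintype.card F) k : ℚ) := by
  obtain ⟨u, hu⟩ : ∃ u, lam u ≠ 0 := by
    by_contra! h
    exact hlam (LinearMap.ext h)
  have hu0 : u ≠ 0 := fun h => hu (by rw [h, map_zero])
  have hker : finrank F (LinearMap.ker lam) = m - 1 := by
    have := Module.Dual.finrank_ker_add_one_of_ne_zero (f := lam) hlam
    rw [finrank_fin_fun] at this
    lia
  have hquot : finrank F ((Fin n → F) ⧸ Submodule.span F {v}) = n - 1 := by
    have := (Submodule.span F {v}).finrank_quotient_add_finrank
    rw [finrank_fin_fun, finrank_span_singleton hv] at this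
    lia
  have hm : m ≠ 0 := by
    rintro rfl
    exact hu0 (Subsingleton.elim _ _)
  have hfin := finite_linearMap (F := F) (V := Fin n → F) (W := Fin m → F)
  have hcount : Nat.card {A : Matrix (Fin m) (Fin n) F //
        A.rank = k ∧ lam (A.mulVec v) = 0 ∧ A.mulVec v ≠ 0 ∧
          ¬ LinearMap.range A.mulVecLin ≤ LinearMap.ker lam} =
      Nat.card {f : (Fin n → F) →ₗ[F] (Fin m → F) //
        (finrank F (LinearMap.range f) = k ∧ f v ∈ {w | w ∈ LinearMap.ker lam ∧ w ≠ 0}) ∧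
          ¬ LinearMap.range f ≤ LinearMap.ker lam} := by
    refine Nat.card_congr ((Matrix.toLin' (R := F)).toEquiv.subtypeEquiv fun A => ?_)
    simp only [and_assoc, Set.mem_ofPred_eq]
    rfl
  have hsplit := natCard_and_add_natCard_and_not
    (fun f : (Fin n → F) →ₗ[F] (Fin m → F) =>
      finrank F (LinearMap.range f) = k ∧ f v ∈ {w | w ∈ LinearMap.ker lam ∧ w ≠ 0})
    (fun f => LinearMap.range f ≤ LinearMap.ker lam)
  rw [← hcount, rankCard_restrict (LinearMap.ker lam)
      (fun f => f v ∈ {w | w ∈ LinearMap.ker lam ∧ w ≠ 0}),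
    natCard_rank_and_apply_mem v hu0 _ (fun w hw => hw.2)] at hsplit
  simp only [Set.mem_ofPred_eq, LinearMap.comp_apply, Submodule.subtype_apply, SetLike.coe_mem,
    true_and, ne_eq, ZeroMemClass.coe_eq_zero] at hsplit
  have hinner := natCard_rank_and_apply_ne_zero (F := F) (W := LinearMap.ker lam) v k
  have houter := natCard_rank_and_apply_ne_zero (F := F) (W := Fin m → F) v k
  have hfibre := natCard_rank_and_apply_mem (F := F) v hu0
    {w | w ∈ (⊤ : Submodule F (Fin m → F)) ∧ w ≠ 0} (fun w hw => hw.2) k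
  simp only [Set.mem_ofPred_eq, Submodule.mem_top, true_and] at hfibre
  have hT := natCard_submodule_ne_zero (LinearMap.ker lam)
  have hT' := natCard_submodule_ne_zero (⊤ : Submodule F (Fin m → F))
  rw [hker] at hT
  rw [finrank_top, finrank_fin_fun] at hT'
  simp only [Submodule.mem_top, true_and] at hT'
  simp only [Set.coe_ofPred, ne_eq] at hsplit hinner houter hfibre hT hT'
  rw [rankCard_eq_grassCard hquot hker, rankCard_eq_grassCard (finrank_fin_fun F) hker] at hinner
  rw [hfibre, rankCard_eq_grassCard hquot (finrank_fin_fun F),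
    rankCard_eq_grassCard (finrank_fin_fun F) (finrank_fin_fun F)] at houter
  have hq : (Fintype.card F : ℚ) ^ m - 1 ≠ 0 :=
    (sub_pos.2 (one_lt_pow₀ (by exact_mod_cast Fintype.one_lt_card) hm)).ne'
  have hsplit' := congrArg (Nat.cast (R := ℚ)) hsplit
  have hinner' := congrArg (Nat.cast (R := ℚ)) hinner
  have houter' := congrArg (Nat.cast (R := ℚ)) houter
  push_cast [hT, hT'] at hsplit' hinner' houter'
  simp only [ne_eq]
  field_simp
  linear_combination ((Fintype.card F : ℚ) ^ m - 1) * hsplit' -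
    ((Fintype.card F : ℚ) ^ m - 1) * hinner' + ((Fintype.card F : ℚ) ^ (m - 1) - 1) * houter'
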